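/- For any irreducible finite set 𝒜 of real m×m matrices, any averaging function γ, any initial norm ‖·‖_0 on ℝ^m and any vector e with ‖e‖_0 = 1, the sequences {ρ⁺_n} and {ρ⁻_n} produced by the max-relaxation iteration both converge to the joint spectral radius ρ(𝒜). -/

import Mathlib

open Matrix Filter Topology Bornology Pointwise

/-- `N` is a norm on `ℝ^m`: nonnegative, definite, absolutely homogeneous, subadditive. -/
def IsNorm {m : ℕ} (N : (Fin m → ℝ) → ℝ) : Prop :=
  (∀ x, 0 ≤ N x) ∧ (∀ x, N x = 0 → x = 0) ∧
    (∀ (t : ℝ) (x), N (t • x) = |t| * N x) ∧ (∀ x y, N (x + y) ≤ N x + N y)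

/-- `N` is a seminorm on `ℝ^m`. -/
def IsSeminorm {m : ℕ} (N : (Fin m → ℝ) → ℝ) : Prop :=
  (∀ x, 0 ≤ N x) ∧
    (∀ (t : ℝ) (x), N (t • x) = |t| * N x) ∧ (∀ x y, N (x + y) ≤ N x + N y)

/-- The family `A` is irreducible: the matrices have no common invariant subspace
other than `⊥` and `⊤`. -/
def IsIrreducibleFamily {m r : ℕ} (A : Fin r → Matrix (Fin m) (Fin m) ℝ) : Prop :=
  ∀ W : Submodule ℝ (Fin m → ℝ), (∀ i, ∀ x ∈ W, (A i).mulVec x ∈ W) → W = ⊥ ∨ W = ⊤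

/-- The operator norm of a matrix acting on `ℝ^m` (with its sup norm). -/
noncomputable def matNorm {m : ℕ} (M : Matrix (Fin m) (Fin m) ℝ) : ℝ :=
  ‖LinearMap.toContinuousLinearMap M.mulVecLin‖

/-- The joint spectral radius of the family `A`:
`limsup_n (max over words of length n of the norm of the product)^(1/n)`. -/
noncomputable def jsr {m r : ℕ} (A : Fin r → Matrix (Fin m) (Fin m) ℝ) : ℝ :=
  Filter.atTop.limsup fun n : ℕ =>
    (⨆ w : Fin n → Fin r, matNorm (List.ofFn fun k => A (w k)).prod) ^ (1 / (n : ℝ))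

/-- `maxA A N x = max_i N (A_i x)`. -/
noncomputable def maxA {m r : ℕ} (A : Fin r → Matrix (Fin m) (Fin m) ℝ)
    (N : (Fin m → ℝ) → ℝ) (x : Fin m → ℝ) : ℝ :=
  ⨆ i, N ((A i).mulVec x)

/-- `ρ⁺ = max_{x ≠ 0} (max_i N (A_i x)) / N x`. -/
noncomputable def rhoSup {m r : ℕ} (A : Fin r → Matrix (Fin m) (Fin m) ℝ)
    (N : (Fin m → ℝ) → ℝ) : ℝ :=
  sSup ((fun x => maxA A N x / N x) '' {x | x ≠ 0})

/-- `ρ⁻ = min_{x ≠ 0} (max_i N (A_i x)) / N x`. -/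
noncomputable def rhoInf {m r : ℕ} (A : Fin r → Matrix (Fin m) (Fin m) ℝ)
    (N : (Fin m → ℝ) → ℝ) : ℝ :=
  sInf ((fun x => maxA A N x / N x) '' {x | x ≠ 0})

/-- An averaging function: continuous on positives, `γ t t = t`, and strictly
between `min` and `max` off the diagonal. -/
def IsAveraging (γ : ℝ → ℝ → ℝ) : Prop :=
  ContinuousOn (fun p : ℝ × ℝ => γ p.1 p.2) {p | 0 < p.1 ∧ 0 < p.2} ∧
    (∀ t, 0 < t → γ t t = t) ∧
    ∀ t s, 0 < t → 0 < s → t ≠ s → min t s < γ t s ∧ γ t s < max t s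

/-- The max-relaxation iteration: `‖x‖_{n+1} = max (‖x‖_n, γ_n⁻¹ max_i ‖A_i x‖_n)`
where `γ_n = γ (ρ⁻_n, ρ⁺_n)`. -/
noncomputable def iterN {m r : ℕ} (A : Fin r → Matrix (Fin m) (Fin m) ℝ)
    (γ : ℝ → ℝ → ℝ) (N0 : (Fin m → ℝ) → ℝ) : ℕ → (Fin m → ℝ) → ℝ
  | 0 => N0
  | n + 1 => fun x =>
      max (iterN A γ N0 n x)
        ((γ (rhoInf A (iterN A γ N0 n)) (rhoSup A (iterN A γ N0 n)))⁻¹ *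
          maxA A (iterN A γ N0 n) x)

/-- The normalized norms `‖x‖°_n = ‖x‖_n / ‖e‖_n` of the max-relaxation iteration
(for `n = 0` this equals `‖x‖_0` since `‖e‖_0 = 1`). -/
noncomputable def iterNnorm {m r : ℕ} (A : Fin r → Matrix (Fin m) (Fin m) ℝ)
    (γ : ℝ → ℝ → ℝ) (N0 : (Fin m → ℝ) → ℝ) (e : Fin m → ℝ) (n : ℕ) :
    (Fin m → ℝ) → ℝ :=
  fun x => iterN A γ N0 n x / iterN A γ N0 n e

/-- `e⁺(N, N') = max_{x ≠ 0} N x / N' x`. -/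
noncomputable def ePlus {m : ℕ} (N N' : (Fin m → ℝ) → ℝ) : ℝ :=
  sSup ((fun x => N x / N' x) '' {x | x ≠ 0})

/-- `e⁻(N, N') = min_{x ≠ 0} N x / N' x`. -/
noncomputable def eMinus {m : ℕ} (N N' : (Fin m → ℝ) → ℝ) : ℝ :=
  sInf ((fun x => N x / N' x) '' {x | x ≠ 0})

/-- The eccentricity of the norm `N` with respect to the norm `N'`. -/
noncomputable def ecc {m : ℕ} (N N' : (Fin m → ℝ) → ℝ) : ℝ :=
  ePlus N N' / eMinus N N'

namespace IsSeminorm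

variable {m : ℕ} {N : (Fin m → ℝ) → ℝ}

theorem map_zero (h : IsSeminorm N) : N 0 = 0 := by
  simpa using h.2.1 0 0

theorem sub_le (h : IsSeminorm N) (x y : Fin m → ℝ) : N x ≤ N y + N (x - y) := by
  simpa using h.2.2 y (x - y)

theorem map_sum_le (h : IsSeminorm N) {ι : Type*} (s : Finset ι) (f : ι → Fin m → ℝ) :
    N (∑ j ∈ s, f j) ≤ ∑ j ∈ s, N (f j) :=
  Finset.le_sum_of_subadditive N h.map_zero.le h.2.2 s f

theorem le_mul_norm (h : IsSeminorm N) (x : Fin m → ℝ) :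
    N x ≤ (∑ j, N (Pi.single j 1)) * ‖x‖ := by
  have hx : x = ∑ j, x j • (Pi.single j 1 : Fin m → ℝ) := by
    ext k
    simp [Finset.sum_apply, Pi.single_apply]
  calc N x = N (∑ j, x j • (Pi.single j 1 : Fin m → ℝ)) := by rw [← hx]
    _ ≤ ∑ j, N (x j • (Pi.single j 1 : Fin m → ℝ)) := h.map_sum_le _ _
    _ ≤ ∑ j, N (Pi.single j 1) * ‖x‖ := by
        refine Finset.sum_le_sum fun j _ => ?_
        rw [h.2.1, mul_comm]
        exact mul_le_mul_of_nonneg_left (norm_le_pi_norm x j) (h.1 _)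
    _ = _ := by rw [Finset.sum_mul]

theorem continuous (h : IsSeminorm N) : Continuous N := by
  have hC : 0 ≤ ∑ j, N (Pi.single j 1) := Finset.sum_nonneg fun j _ => h.1 _
  refine (LipschitzWith.of_le_add_mul ⟨_, hC⟩ fun x y => ?_).continuous
  rw [dist_eq_norm]
  exact (h.sub_le x y).trans (add_le_add le_rfl (h.le_mul_norm _))

theorem const_mul (h : IsSeminorm N) {c : ℝ} (hc : 0 ≤ c) : IsSeminorm fun x => c * N x := by
  refine ⟨fun x => mul_nonneg hc (h.1 x), fun t x => ?_, fun x y => ?_⟩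
  · simp only [h.2.1]; ring
  · rw [← mul_add]
    exact mul_le_mul_of_nonneg_left (h.2.2 x y) hc

theorem max {N' : (Fin m → ℝ) → ℝ} (h : IsSeminorm N) (h' : IsSeminorm N') :
    IsSeminorm fun x => Max.max (N x) (N' x) := by
  refine ⟨fun x => le_max_of_le_left (h.1 x), fun t x => ?_, fun x y => ?_⟩
  · simp only [h.2.1, h'.2.1]
    rw [mul_max_of_nonneg _ _ (abs_nonneg t)]
  · exact max_le ((h.2.2 x y).trans (add_le_add (le_max_left _ _) (le_max_left _ _)))
      ((h'.2.2 x y).trans (add_le_add (le_max_right _ _) (le_max_right _ _)))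

end IsSeminorm

section maxA

variable {m r : ℕ} {A : Fin r → Matrix (Fin m) (Fin m) ℝ} {N : (Fin m → ℝ) → ℝ}

theorem le_maxA (A : Fin r → Matrix (Fin m) (Fin m) ℝ) (N : (Fin m → ℝ) → ℝ) (i : Fin r)
    (x : Fin m → ℝ) : N ((A i).mulVec x) ≤ maxA A N x :=
  le_ciSup (f := fun i => N ((A i).mulVec x)) (Set.finite_range _).bddAbove i

theorem maxA_le [Nonempty (Fin r)] {x : Fin m → ℝ} {c : ℝ}
    (h : ∀ i, N ((A i).mulVec x) ≤ c) : maxA A N x ≤ c :=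
  ciSup_le h

theorem exists_maxA_eq [Nonempty (Fin r)] (A : Fin r → Matrix (Fin m) (Fin m) ℝ)
    (N : (Fin m → ℝ) → ℝ) (x : Fin m → ℝ) : ∃ i, N ((A i).mulVec x) = maxA A N x :=
  exists_eq_ciSup_of_finite

theorem IsSeminorm.maxA [Nonempty (Fin r)] (h : IsSeminorm N)
    (A : Fin r → Matrix (Fin m) (Fin m) ℝ) : IsSeminorm (maxA A N) := by
  refine ⟨fun x => ?_, fun t x => ?_, fun x y => maxA_le fun i => ?_⟩
  · exact (h.1 _).trans (le_maxA A N (Classical.arbitrary _) x)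
  · simp only [_root_.maxA, Matrix.mulVec_smul, h.2.1]
    rw [Real.mul_iSup_of_nonneg (abs_nonneg t)]
  · rw [Matrix.mulVec_add]
    exact (h.2.2 _ _).trans (add_le_add (le_maxA A N i x) (le_maxA A N i y))

end maxA

namespace IsNorm

variable {m r : ℕ} {N : (Fin m → ℝ) → ℝ} {A : Fin r → Matrix (Fin m) (Fin m) ℝ}

theorem isSeminorm (h : IsNorm N) : IsSeminorm N := ⟨h.1, h.2.2⟩

theorem pos (h : IsNorm N) {x : Fin m → ℝ} (hx : x ≠ 0) : 0 < N x :=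
  (h.1 x).lt_of_ne fun h0 => hx (h.2.1 x h0.symm)

theorem exists_mul_norm_le [Nonempty (Fin m)] (h : IsNorm N) :
    ∃ c, 0 < c ∧ ∀ x, c * ‖x‖ ≤ N x := by
  obtain ⟨z, hz, hmin⟩ := (isCompact_sphere (0 : Fin m → ℝ) 1).exists_isMinOn
    (NormedSpace.sphere_nonempty.2 zero_le_one) h.isSeminorm.continuous.continuousOn
  have hz0 : z ≠ 0 := by
    rintro rfl
    simp at hz
  refine ⟨N z, h.pos hz0, fun x => ?_⟩
  rcases eq_or_ne x 0 with rfl | hx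
  · simp [h.isSeminorm.map_zero]
  have hx' : 0 < ‖x‖ := norm_pos_iff.2 hx
  have key : N z ≤ N (‖x‖⁻¹ • x) := hmin (by
    simp [norm_smul, hx'.ne'])
  rw [h.2.2.1, abs_of_pos (inv_pos.2 hx'), inv_mul_eq_div, le_div_iff₀ hx'] at key
  exact key

theorem exists_pos_mul_le [Nonempty (Fin m)] {N' : (Fin m → ℝ) → ℝ} (h : IsNorm N)
    (h' : IsSeminorm N') : ∃ C, 0 < C ∧ ∀ x, N' x ≤ C * N x := by
  obtain ⟨c, hc, hcN⟩ := h.exists_mul_norm_le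
  have hS : 0 ≤ ∑ j, N' (Pi.single j 1) := Finset.sum_nonneg fun j _ => h'.1 _
  refine ⟨(∑ j, N' (Pi.single j 1)) / c + 1, by positivity, fun x => ?_⟩
  calc N' x ≤ (∑ j, N' (Pi.single j 1)) * ‖x‖ := h'.le_mul_norm x
    _ = (∑ j, N' (Pi.single j 1)) / c * (c * ‖x‖) := by field_simp
    _ ≤ (∑ j, N' (Pi.single j 1)) / c * N x := by gcongr; exact hcN x
    _ ≤ _ := by nlinarith [h.1 x]

theorem maxA_le_rhoSup_mul [Nonempty (Fin m)] [Nonempty (Fin r)] (h : IsNorm N)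
    (A : Fin r → Matrix (Fin m) (Fin m) ℝ) (x : Fin m → ℝ) :
    maxA A N x ≤ rhoSup A N * N x := by
  rcases eq_or_ne x 0 with rfl | hx
  · rw [(h.isSeminorm.maxA A).map_zero, h.isSeminorm.map_zero, mul_zero]
  obtain ⟨C, -, hC⟩ := h.exists_pos_mul_le (h.isSeminorm.maxA A)
  rw [← div_le_iff₀ (h.pos hx)]
  refine le_csSup ⟨C, ?_⟩ ⟨x, hx, rfl⟩
  rintro _ ⟨y, hy, rfl⟩
  exact (div_le_iff₀ (h.pos hy)).2 (hC y)

theorem rhoSup_le [Nonempty (Fin m)] (h : IsNorm N) {c : ℝ}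
    (hc : ∀ x, maxA A N x ≤ c * N x) : rhoSup A N ≤ c := by
  obtain ⟨x, hx⟩ := exists_ne (0 : Fin m → ℝ)
  refine csSup_le ⟨_, x, hx, rfl⟩ ?_
  rintro _ ⟨y, hy, rfl⟩
  exact (div_le_iff₀ (h.pos hy)).2 (hc y)

theorem bddBelow_div [Nonempty (Fin r)] (h : IsNorm N)
    (A : Fin r → Matrix (Fin m) (Fin m) ℝ) :
    BddBelow ((fun x => maxA A N x / N x) '' {x | x ≠ 0}) := by
  refine ⟨0, ?_⟩
  rintro _ ⟨y, -, rfl⟩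
  exact div_nonneg ((h.isSeminorm.maxA A).1 y) (h.1 y)

theorem rhoInf_mul_le_maxA [Nonempty (Fin r)] (h : IsNorm N)
    (A : Fin r → Matrix (Fin m) (Fin m) ℝ) (x : Fin m → ℝ) :
    rhoInf A N * N x ≤ maxA A N x := by
  rcases eq_or_ne x 0 with rfl | hx
  · rw [(h.isSeminorm.maxA A).map_zero, h.isSeminorm.map_zero, mul_zero]
  rw [← le_div_iff₀ (h.pos hx)]
  exact csInf_le (h.bddBelow_div A) ⟨x, hx, rfl⟩

theorem le_rhoInf [Nonempty (Fin m)] (h : IsNorm N) {c : ℝ}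
    (hc : ∀ x, c * N x ≤ maxA A N x) : c ≤ rhoInf A N := by
  obtain ⟨x, hx⟩ := exists_ne (0 : Fin m → ℝ)
  refine le_csInf ⟨_, x, hx, rfl⟩ ?_
  rintro _ ⟨y, hy, rfl⟩
  exact (le_div_iff₀ (h.pos hy)).2 (hc y)

theorem exists_maxA_lt_of_rhoInf_lt [Nonempty (Fin m)] (h : IsNorm N) {s : ℝ}
    (hs : rhoInf A N < s) : ∃ x ≠ 0, maxA A N x < s * N x := by
  obtain ⟨x, hx⟩ := exists_ne (0 : Fin m → ℝ)
  obtain ⟨_, ⟨y, hy, rfl⟩, hlt⟩ := exists_lt_of_csInf_lt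
    (Set.Nonempty.image _ ⟨x, hx⟩) hs
  exact ⟨y, hy, (div_lt_iff₀ (h.pos hy)).1 hlt⟩

theorem rhoInf_le_rhoSup [Nonempty (Fin m)] [Nonempty (Fin r)] (h : IsNorm N)
    (A : Fin r → Matrix (Fin m) (Fin m) ℝ) : rhoInf A N ≤ rhoSup A N := by
  obtain ⟨x, hx⟩ := exists_ne (0 : Fin m → ℝ)
  exact le_of_mul_le_mul_right ((h.rhoInf_mul_le_maxA A x).trans (h.maxA_le_rhoSup_mul A x))
    (h.pos hx)

end IsNorm

section Irreducible

variable {m r : ℕ} {A : Fin r → Matrix (Fin m) (Fin m) ℝ}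

theorem IsIrreducibleFamily.exists_mulVec_ne_zero (hm : 2 ≤ m) (hA : IsIrreducibleFamily A)
    {x : Fin m → ℝ} (hx : x ≠ 0) : ∃ i, (A i).mulVec x ≠ 0 := by
  by_contra! h
  rcases hA (Submodule.span ℝ {x}) (fun i y hy => by
    obtain ⟨t, rfl⟩ := Submodule.mem_span_singleton.1 hy
    simp [Matrix.mulVec_smul, h i]) with hW | hW
  · exact hx (Submodule.span_singleton_eq_bot.1 hW)
  · have h1 : Module.finrank ℝ (Submodule.span ℝ {x}) = 1 := finrank_span_singleton hx
    rw [hW, finrank_top, Module.finrank_fin_fun] at h1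
    omega

theorem IsNorm.maxA [Nonempty (Fin r)] {N : (Fin m → ℝ) → ℝ} (h : IsNorm N) (hm : 2 ≤ m)
    (hA : IsIrreducibleFamily A) : IsNorm (maxA A N) := by
  refine ⟨(h.isSeminorm.maxA A).1, fun x hx => ?_, (h.isSeminorm.maxA A).2⟩
  by_contra hx0
  obtain ⟨i, hi⟩ := hA.exists_mulVec_ne_zero hm hx0
  exact (h.pos hi).not_ge (hx ▸ le_maxA A N i x)

theorem IsNorm.rhoInf_pos [Nonempty (Fin m)] [Nonempty (Fin r)] {N : (Fin m → ℝ) → ℝ}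
    (h : IsNorm N) (hm : 2 ≤ m) (hA : IsIrreducibleFamily A) : 0 < rhoInf A N := by
  obtain ⟨C, hC, hle⟩ := (h.maxA hm hA).exists_pos_mul_le h.isSeminorm
  refine (inv_pos.2 hC).trans_le (h.le_rhoInf fun x => ?_)
  rw [inv_mul_le_iff₀ hC]
  exact hle x

/-- At a fixed nonzero vector, all seminorms contracted by the family up to the factor `R`
are bounded by their value there. -/
theorem IsIrreducibleFamily.exists_le_at (hA : IsIrreducibleFamily A) {R : ℝ} (hR : 0 ≤ R)
    {x : Fin m → ℝ} (hx : x ≠ 0) :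
    ∃ C, 0 ≤ C ∧ ∀ N, IsSeminorm N → (∀ i z, N ((A i).mulVec z) ≤ R * N z) →
      ∀ y, N y ≤ C * ‖y‖ * N x := by
  let W : Submodule ℝ (Fin m → ℝ) :=
    { carrier := {y | ∃ C, 0 ≤ C ∧ ∀ N, IsSeminorm N →
        (∀ i z, N ((A i).mulVec z) ≤ R * N z) → N y ≤ C * N x}
      zero_mem' := ⟨0, le_rfl, fun N hN _ => by simp [hN.map_zero]⟩
      add_mem' := by
        rintro y z ⟨C, hC, hy⟩ ⟨D, hD, hz⟩
        refine ⟨C + D, by positivity, fun N hN hNA => (hN.2.2 y z).trans ?_⟩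
        rw [add_mul]
        exact add_le_add (hy N hN hNA) (hz N hN hNA)
      smul_mem' := by
        rintro t y ⟨C, hC, hy⟩
        refine ⟨|t| * C, by positivity, fun N hN hNA => ?_⟩
        rw [hN.2.1, mul_assoc]
        exact mul_le_mul_of_nonneg_left (hy N hN hNA) (abs_nonneg t) }
  have hxW : x ∈ W := ⟨1, zero_le_one, fun N _ _ => by simp⟩
  have hW : W = ⊤ := by
    refine (hA W ?_).resolve_left fun h => hx (by simpa [h] using hxW)
    rintro i y ⟨C, hC, hy⟩
    refine ⟨R * C, by positivity, fun N hN hNA => (hNA i y).trans ?_⟩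
    rw [mul_assoc]
    exact mul_le_mul_of_nonneg_left (hy N hN hNA) hR
  have hall : ∀ y, y ∈ W := fun y => hW ▸ Submodule.mem_top
  choose C hC hCN using fun j : Fin m => hall (Pi.single j 1)
  refine ⟨∑ j, C j, Finset.sum_nonneg fun j _ => hC j, fun N hN hNA y => ?_⟩
  calc N y ≤ (∑ j, N (Pi.single j 1)) * ‖y‖ := hN.le_mul_norm y
    _ ≤ (∑ j, C j * N x) * ‖y‖ := by
        gcongr with j
        exact hCN j N hN hNA
    _ = _ := by rw [← Finset.sum_mul]; ring

theorem IsIrreducibleFamily.exists_uniform_le (hA : IsIrreducibleFamily A) {R : ℝ}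
    (hR : 0 ≤ R) :
    ∃ C, 0 ≤ C ∧ ∀ N, IsSeminorm N → (∀ i z, N ((A i).mulVec z) ≤ R * N z) →
      ∀ x y, ‖x‖ * N y ≤ C * ‖y‖ * N x := by
  have hcomp : ∃ C, 0 ≤ C ∧ ∀ x ∈ Metric.sphere (0 : Fin m → ℝ) 1, ∀ N, IsSeminorm N →
      (∀ i z, N ((A i).mulVec z) ≤ R * N z) → ∀ y, N y ≤ C * ‖y‖ * N x := by
    refine (isCompact_sphere (0 : Fin m → ℝ) 1).induction_on
      (p := fun S => ∃ C, 0 ≤ C ∧ ∀ x ∈ S, ∀ N, IsSeminorm N →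
        (∀ i z, N ((A i).mulVec z) ≤ R * N z) → ∀ y, N y ≤ C * ‖y‖ * N x) ?_ ?_ ?_ ?_
    · exact ⟨0, le_rfl, by simp⟩
    · rintro S T hST ⟨C, hC, h⟩
      exact ⟨C, hC, fun x hx => h x (hST hx)⟩
    · rintro S T ⟨C, hC, h⟩ ⟨D, hD, h'⟩
      refine ⟨C + D, by positivity, fun x hx N hN hNA y => ?_⟩
      have hx0 := hN.1 x
      rcases hx with hx | hx
      · refine (h x hx N hN hNA y).trans ?_
        gcongr
        linarith
      · refine (h' x hx N hN hNA y).trans ?_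
        gcongr
        linarith
    · intro x hx
      have hx0 : x ≠ 0 := by
        rintro rfl
        simp at hx
      obtain ⟨C, hC, h⟩ := hA.exists_le_at hR hx0
      refine ⟨_, mem_nhdsWithin_of_mem_nhds (Metric.ball_mem_nhds x
        (show 0 < 1 / (2 * (C + 1)) by positivity)), 2 * C, by positivity,
        fun z hz N hN hNA y => ?_⟩
      rw [mem_ball_iff_norm', lt_div_iff₀ (by positivity)] at hz
      have hxz : N x ≤ 2 * N z := by
        have h1 := hN.sub_le x z
        have h2 := h N hN hNA (x - z)
        have h3 : C * ‖x - z‖ ≤ 1 / 2 := by nlinarith [norm_nonneg (x - z)]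
        nlinarith [hN.1 x]
      calc N y ≤ C * ‖y‖ * N x := h N hN hNA y
        _ ≤ C * ‖y‖ * (2 * N z) := by gcongr
        _ = _ := by ring
  obtain ⟨C, hC, h⟩ := hcomp
  refine ⟨C, hC, fun N hN hNA x y => ?_⟩
  rcases eq_or_ne x 0 with rfl | hx
  · simp [hN.map_zero]
  have hx' : 0 < ‖x‖ := norm_pos_iff.2 hx
  have key := h (‖x‖⁻¹ • x) (by simp [norm_smul, hx'.ne']) N hN hNA y
  rw [hN.2.1, abs_of_pos (inv_pos.2 hx')] at key
  calc ‖x‖ * N y ≤ ‖x‖ * (C * ‖y‖ * (‖x‖⁻¹ * N x)) := by gcongr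
    _ = _ := by field_simp

end Irreducible

section JointSpectralRadius

variable {m r : ℕ} {A : Fin r → Matrix (Fin m) (Fin m) ℝ} {N : (Fin m → ℝ) → ℝ}

theorem norm_mulVec_le_matNorm (M : Matrix (Fin m) (Fin m) ℝ) (x : Fin m → ℝ) :
    ‖M.mulVec x‖ ≤ matNorm M * ‖x‖ :=
  (LinearMap.toContinuousLinearMap M.mulVecLin).le_opNorm x

theorem matNorm_le {M : Matrix (Fin m) (Fin m) ℝ} {c : ℝ} (hc : 0 ≤ c)
    (h : ∀ x, ‖M.mulVec x‖ ≤ c * ‖x‖) : matNorm M ≤ c :=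
  ContinuousLinearMap.opNorm_le_bound _ hc h

theorem map_prod_mulVec_le {b : ℝ} (hb : 0 ≤ b) (h : ∀ i x, N ((A i).mulVec x) ≤ b * N x) :
    ∀ (n : ℕ) (w : Fin n → Fin r) (x : Fin m → ℝ),
      N ((List.ofFn fun k => A (w k)).prod.mulVec x) ≤ b ^ n * N x
  | 0, w, x => by simp
  | n + 1, w, x => by
      rw [List.ofFn_succ, List.prod_cons, ← Matrix.mulVec_mulVec, pow_succ', mul_assoc]
      exact (h _ _).trans (mul_le_mul_of_nonneg_left
        (map_prod_mulVec_le hb h n (fun k => w k.succ) x) hb)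

theorem exists_pow_mul_le_map_prod [Nonempty (Fin r)] {a : ℝ} (ha : 0 ≤ a)
    (h : ∀ x, a * N x ≤ maxA A N x) (x : Fin m → ℝ) :
    ∀ n : ℕ, ∃ w : Fin n → Fin r,
      a ^ n * N x ≤ N ((List.ofFn fun k => A (w k)).prod.mulVec x)
  | 0 => ⟨Fin.elim0, by simp⟩
  | n + 1 => by
      obtain ⟨w, hw⟩ := exists_pow_mul_le_map_prod ha h x n
      obtain ⟨i, hi⟩ := exists_maxA_eq A N ((List.ofFn fun k => A (w k)).prod.mulVec x)
      refine ⟨Fin.cons i w, ?_⟩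
      rw [List.ofFn_succ, List.prod_cons, ← Matrix.mulVec_mulVec, pow_succ', mul_assoc]
      simp only [Fin.cons_zero, Fin.cons_succ]
      rw [hi]
      exact (mul_le_mul_of_nonneg_left hw ha).trans (h _)

theorem tendsto_mul_pow_rpow {C b : ℝ} (hC : 0 < C) (hb : 0 ≤ b) :
    Tendsto (fun n : ℕ => (C * b ^ n) ^ (1 / (n : ℝ))) atTop (𝓝 b) := by
  have h1 : Tendsto (fun n : ℕ => C ^ (1 / (n : ℝ)) * b) atTop (𝓝 (C ^ (0 : ℝ) * b)) :=
    ((tendsto_const_nhds.rpow tendsto_one_div_atTop_nhds_zero_nat (Or.inl hC.ne'))).mul_const b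
  rw [Real.rpow_zero, one_mul] at h1
  refine h1.congr' ?_
  filter_upwards [eventually_ne_atTop 0] with n hn
  rw [Real.mul_rpow hC.le (pow_nonneg hb n), one_div, Real.pow_rpow_inv_natCast hb hn]

theorem jsr_mem_Icc [Nonempty (Fin m)] [Nonempty (Fin r)] (hN : IsNorm N) {a b : ℝ}
    (ha : 0 ≤ a) (hb : 0 ≤ b) (haN : ∀ x, a * N x ≤ maxA A N x)
    (hbN : ∀ x, maxA A N x ≤ b * N x) : jsr A ∈ Set.Icc a b := by
  obtain ⟨c, hc, hcN⟩ := hN.exists_mul_norm_le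
  obtain ⟨D, hD, hDN⟩ : ∃ D, 0 < D ∧ ∀ x, N x ≤ D * ‖x‖ :=
    ⟨(∑ j, N (Pi.single j 1)) + 1,
      add_pos_of_nonneg_of_pos (Finset.sum_nonneg fun j _ => hN.1 _) one_pos, fun x =>
      (hN.isSeminorm.le_mul_norm x).trans (by gcongr; linarith)⟩
  obtain ⟨z, hz⟩ := exists_ne (0 : Fin m → ℝ)
  have hz' : 0 < ‖z‖ := norm_pos_iff.2 hz
  set S : ℕ → ℝ := fun n => ⨆ w : Fin n → Fin r, matNorm (List.ofFn fun k => A (w k)).prod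
  have hSb : ∀ n, S n ≤ D / c * b ^ n := fun n => by
    refine ciSup_le fun w => matNorm_le (by positivity) fun x => ?_
    have h1 := hcN ((List.ofFn fun k => A (w k)).prod.mulVec x)
    have h2 := map_prod_mulVec_le hb (fun i x => (le_maxA A N i x).trans (hbN x)) n w x
    have h3 := mul_le_mul_of_nonneg_left (hDN x) (pow_nonneg hb n)
    rw [div_mul_eq_mul_div, div_mul_eq_mul_div, le_div_iff₀ hc]
    linarith
  have hSa : ∀ n, c / D * a ^ n ≤ S n := fun n => by
    obtain ⟨w, hw⟩ := exists_pow_mul_le_map_prod ha haN z n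
    refine le_trans ?_ (le_ciSup (Set.finite_range _).bddAbove w)
    have h1 := norm_mulVec_le_matNorm (List.ofFn fun k => A (w k)).prod z
    have h2 := hDN ((List.ofFn fun k => A (w k)).prod.mulVec z)
    have h3 := mul_le_mul_of_nonneg_left (hcN z) (pow_nonneg ha n)
    have h4 := mul_le_mul_of_nonneg_left h1 hD.le
    rw [div_mul_eq_mul_div, div_le_iff₀ hD]
    refine le_of_mul_le_mul_right ?_ hz'
    linarith
  have ta := tendsto_mul_pow_rpow (div_pos hc hD) ha
  have tb := tendsto_mul_pow_rpow (div_pos hD hc) hb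
  have hS0 : ∀ n, 0 ≤ S n := fun n => le_trans (by positivity) (hSa n)
  have ha' : ∀ n : ℕ, (c / D * a ^ n) ^ (1 / (n : ℝ)) ≤ S n ^ (1 / (n : ℝ)) := fun n =>
    Real.rpow_le_rpow (by positivity) (hSa n) (by positivity)
  have hb' : ∀ n : ℕ, S n ^ (1 / (n : ℝ)) ≤ (D / c * b ^ n) ^ (1 / (n : ℝ)) := fun n =>
    Real.rpow_le_rpow (hS0 n) (hSb n) (by positivity)
  have hub : IsBoundedUnder (· ≤ ·) atTop fun n : ℕ => S n ^ (1 / (n : ℝ)) :=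
    tb.isBoundedUnder_le.mono_le (Eventually.of_forall hb')
  have hlb : IsBoundedUnder (· ≥ ·) atTop fun n : ℕ => S n ^ (1 / (n : ℝ)) :=
    ta.isBoundedUnder_ge.mono_ge (Eventually.of_forall ha')
  constructor
  · rw [← ta.limsup_eq]
    exact limsup_le_limsup (Eventually.of_forall ha') ta.isCoboundedUnder_le hub
  · rw [← tb.limsup_eq]
    exact limsup_le_limsup (Eventually.of_forall hb') hlb.isCoboundedUnder_le
      tb.isBoundedUnder_le

end JointSpectralRadius

namespace IsAveraging

variable {γ : ℝ → ℝ → ℝ}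

theorem pos (hγ : IsAveraging γ) {t s : ℝ} (ht : 0 < t) (hs : 0 < s) : 0 < γ t s := by
  rcases eq_or_ne t s with rfl | hne
  · rwa [hγ.2.1 t ht]
  · exact (lt_min ht hs).trans (hγ.2.2 t s ht hs hne).1

theorem tendsto (hγ : IsAveraging γ) {a b : ℕ → ℝ} {α β : ℝ} (hα : 0 < α) (hβ : 0 < β)
    (ha : Tendsto a atTop (𝓝 α)) (hb : Tendsto b atTop (𝓝 β)) :
    Tendsto (fun n => γ (a n) (b n)) atTop (𝓝 (γ α β)) := by
  have hopen : IsOpen {p : ℝ × ℝ | 0 < p.1 ∧ 0 < p.2} :=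
    (isOpen_lt continuous_const continuous_fst).inter
      (isOpen_lt continuous_const continuous_snd)
  have hcont : ContinuousAt (fun p : ℝ × ℝ => γ p.1 p.2) (α, β) :=
    hγ.1.continuousAt (hopen.mem_nhds ⟨hα, hβ⟩)
  exact hcont.tendsto.comp (ha.prodMk_nhds hb)

end IsAveraging

section RelaxationStep

variable {m r : ℕ} {A : Fin r → Matrix (Fin m) (Fin m) ℝ} {N : (Fin m → ℝ) → ℝ}

theorem IsNorm.max_mul_maxA [Nonempty (Fin r)] (h : IsNorm N) {g : ℝ} (hg : 0 < g) :
    IsNorm fun x => max (N x) (g⁻¹ * _root_.maxA A N x) :=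
  have hs := h.isSeminorm.max ((h.isSeminorm.maxA A).const_mul (inv_pos.2 hg).le)
  ⟨hs.1, fun x hx => h.2.1 x (le_antisymm (hx ▸ le_max_left _ _) (h.1 x)), hs.2⟩

theorem maxA_max_mul_maxA_le [Nonempty (Fin r)] {g b : ℝ} (hg : 0 < g) (hb : 0 ≤ b)
    (h : ∀ x, maxA A N x ≤ b * N x) (x : Fin m → ℝ) :
    maxA A (fun x => max (N x) (g⁻¹ * maxA A N x)) x ≤ b * max (N x) (g⁻¹ * maxA A N x) := by
  have hginv := (inv_pos.2 hg).le
  refine maxA_le fun i => ?_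
  rw [mul_max_of_nonneg _ _ hb]
  refine max_le_max ((le_maxA A N i x).trans (h x)) ?_
  calc g⁻¹ * maxA A N ((A i).mulVec x) ≤ g⁻¹ * (b * maxA A N x) := by
        gcongr
        exact (h _).trans (mul_le_mul_of_nonneg_left (le_maxA A N i x) hb)
    _ = _ := by ring

theorem le_maxA_max_mul_maxA [Nonempty (Fin r)] {g a : ℝ} (hg : 0 < g) (ha : 0 ≤ a)
    (h : ∀ x, a * N x ≤ maxA A N x) (x : Fin m → ℝ) :
    a * max (N x) (g⁻¹ * maxA A N x) ≤ maxA A (fun x => max (N x) (g⁻¹ * maxA A N x)) x := by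
  have hginv := (inv_pos.2 hg).le
  obtain ⟨i, hi⟩ := exists_maxA_eq A N x
  refine le_trans ?_ (le_maxA A _ i x)
  rw [mul_max_of_nonneg _ _ ha]
  refine max_le_max (hi ▸ h x) ?_
  calc a * (g⁻¹ * maxA A N x) = g⁻¹ * (a * N ((A i).mulVec x)) := by rw [hi]; ring
    _ ≤ _ := mul_le_mul_of_nonneg_left (h _) hginv

/-- If the relaxed norm is contracted at `x` by a factor below the relaxation parameter, then
so is the original norm, and the relaxation step does not change the norm of `x`. -/
theorem maxA_le_of_maxA_max_mul_maxA_le [Nonempty (Fin r)] (hN : IsNorm N) {g s : ℝ}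
    (hs : 0 ≤ s) (hsg : s < g) {x : Fin m → ℝ}
    (h : maxA A (fun x => max (N x) (g⁻¹ * maxA A N x)) x ≤ s * max (N x) (g⁻¹ * maxA A N x)) :
    maxA A N x ≤ s * N x ∧ max (N x) (g⁻¹ * maxA A N x) = N x := by
  have hg : 0 < g := hs.trans_lt hsg
  have h1 : maxA A N x ≤ s * max (N x) (g⁻¹ * maxA A N x) :=
    (maxA_le fun i => (le_max_left _ _).trans
      (le_maxA A (fun x => max (N x) (g⁻¹ * maxA A N x)) i x)).trans h
  have h0 := (hN.isSeminorm.maxA A).1 x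
  have key : maxA A N x ≤ s * N x := by
    rw [mul_max_of_nonneg _ _ hs] at h1
    rcases le_max_iff.1 h1 with h2 | h2
    · exact h2
    · have h3 : maxA A N x * (g - s) ≤ 0 := by
        rw [← mul_assoc, ← div_eq_mul_inv, div_mul_eq_mul_div, le_div_iff₀ hg] at h2
        linarith
      have h4 : maxA A N x ≤ 0 := by
        by_contra! hpos
        exact (mul_pos hpos (sub_pos.2 hsg)).not_ge h3
      exact h4.trans (mul_nonneg hs (hN.1 x))
  refine ⟨key, max_eq_left ?_⟩
  rw [inv_mul_le_iff₀ hg]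
  exact key.trans (mul_le_mul_of_nonneg_right hsg.le (hN.1 x))

end RelaxationStep

/-- If an increasing sequence of norms stays bounded, the ratio of consecutive norms
converges to one, uniformly in the vector. -/
theorem eventually_succ_le_mul {m : ℕ} [Nonempty (Fin m)] {N : ℕ → (Fin m → ℝ) → ℝ}
    (hN : ∀ n, IsNorm (N n)) (hmono : ∀ x, Monotone fun n => N n x) {K : ℝ}
    (hK : ∀ n x, N n x ≤ K * ‖x‖) {ε : ℝ} (hε : 0 < ε) :
    ∀ᶠ n in atTop, ∀ x, N (n + 1) x ≤ (1 + ε) * N n x := by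
  obtain ⟨c, hc, hcN⟩ := (hN 0).exists_mul_norm_le
  have hbdd : ∀ x, BddAbove (Set.range fun n => N n x) := fun x =>
    ⟨K * ‖x‖, by rintro _ ⟨n, rfl⟩; exact hK n x⟩
  have hlim : ∀ x, Tendsto (fun n => N n x) atTop (𝓝 (⨆ n, N n x)) := fun x =>
    tendsto_atTop_ciSup (hmono x) (hbdd x)
  have hsemi : IsSeminorm fun x => ⨆ n, N n x := by
    refine ⟨fun x => Real.iSup_nonneg fun n => (hN n).1 x, fun t x => ?_, fun x y => ?_⟩
    · simp only [fun n => (hN n).2.2.1 t x]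
      rw [Real.mul_iSup_of_nonneg (abs_nonneg t)]
    · exact ciSup_le fun n => ((hN n).2.2.2 x y).trans
        (add_le_add (le_ciSup (hbdd x) n) (le_ciSup (hbdd y) n))
  have hdini := Monotone.tendstoUniformlyOn_of_forall_tendsto
    (isCompact_sphere (0 : Fin m → ℝ) 1)
    (fun n => (hN n).isSeminorm.continuous.continuousOn) (fun x _ => hmono x)
    hsemi.continuous.continuousOn (fun x _ => hlim x)
  filter_upwards [Metric.tendstoUniformlyOn_iff.1 hdini (ε * c) (by positivity)] with n hn x
  rcases eq_or_ne x 0 with rfl | hx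
  · simp [(hN _).isSeminorm.map_zero]
  have hx' : 0 < ‖x‖ := norm_pos_iff.2 hx
  have h1 := (le_abs_self _).trans (hn (‖x‖⁻¹ • x) (by simp [norm_smul, hx'.ne'])).le
  have h2 := le_ciSup (hbdd (‖x‖⁻¹ • x)) (n + 1)
  have h3 : N (n + 1) (‖x‖⁻¹ • x) ≤ N n (‖x‖⁻¹ • x) + ε * c := by linarith
  rw [(hN _).2.2.1, (hN _).2.2.1, abs_of_pos (inv_pos.2 hx'), inv_mul_le_iff₀ hx', mul_add,
    mul_inv_cancel_left₀ hx'.ne'] at h3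
  have h4 := mul_le_mul_of_nonneg_left ((hcN x).trans (hmono x (Nat.zero_le n))) hε.le
  dsimp only at h4
  linarith

section Iteration

variable {m r : ℕ} {A : Fin r → Matrix (Fin m) (Fin m) ℝ} {γ : ℝ → ℝ → ℝ}
  {N0 : (Fin m → ℝ) → ℝ}

/-- The relaxation parameter `γ (ρ⁻_n, ρ⁺_n)` of the max-relaxation iteration. -/
noncomputable def relaxParam (A : Fin r → Matrix (Fin m) (Fin m) ℝ) (γ : ℝ → ℝ → ℝ)
    (N0 : (Fin m → ℝ) → ℝ) (n : ℕ) : ℝ :=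
  γ (rhoInf A (iterN A γ N0 n)) (rhoSup A (iterN A γ N0 n))

theorem monotone_iterN (A : Fin r → Matrix (Fin m) (Fin m) ℝ) (γ : ℝ → ℝ → ℝ)
    (N0 : (Fin m → ℝ) → ℝ) (x : Fin m → ℝ) : Monotone fun n => iterN A γ N0 n x :=
  monotone_nat_of_le_succ fun _ => le_max_left _ _

variable [Nonempty (Fin m)] [Nonempty (Fin r)]

theorem isNorm_iterN (hm : 2 ≤ m) (hA : IsIrreducibleFamily A) (hγ : IsAveraging γ)
    (hN0 : IsNorm N0) : ∀ n, IsNorm (iterN A γ N0 n)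
  | 0 => hN0
  | n + 1 =>
      have h := isNorm_iterN hm hA hγ hN0 n
      have ha := h.rhoInf_pos hm hA
      h.max_mul_maxA (hγ.pos ha (ha.trans_le (h.rhoInf_le_rhoSup A)))

theorem relaxParam_pos (hm : 2 ≤ m) (hA : IsIrreducibleFamily A) (hγ : IsAveraging γ)
    (hN0 : IsNorm N0) (n : ℕ) : 0 < relaxParam A γ N0 n :=
  have h := isNorm_iterN hm hA hγ hN0 n
  have ha := h.rhoInf_pos hm hA
  hγ.pos ha (ha.trans_le (h.rhoInf_le_rhoSup A))

theorem antitone_rhoSup_iterN (hm : 2 ≤ m) (hA : IsIrreducibleFamily A) (hγ : IsAveraging γ)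
    (hN0 : IsNorm N0) : Antitone fun n => rhoSup A (iterN A γ N0 n) :=
  antitone_nat_of_succ_le fun n =>
    have h := isNorm_iterN hm hA hγ hN0 n
    (isNorm_iterN hm hA hγ hN0 (n + 1)).rhoSup_le
      (maxA_max_mul_maxA_le (relaxParam_pos hm hA hγ hN0 n)
        ((h.rhoInf_pos hm hA).le.trans (h.rhoInf_le_rhoSup A)) (h.maxA_le_rhoSup_mul A))

theorem monotone_rhoInf_iterN (hm : 2 ≤ m) (hA : IsIrreducibleFamily A) (hγ : IsAveraging γ)
    (hN0 : IsNorm N0) : Monotone fun n => rhoInf A (iterN A γ N0 n) :=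
  monotone_nat_of_le_succ fun n =>
    have h := isNorm_iterN hm hA hγ hN0 n
    (isNorm_iterN hm hA hγ hN0 (n + 1)).le_rhoInf
      (le_maxA_max_mul_maxA (relaxParam_pos hm hA hγ hN0 n) (h.rhoInf_pos hm hA).le
        (h.rhoInf_mul_le_maxA A))

/-- If the relaxation parameters eventually stay above a strict upper bound of all `ρ⁻_n`,
then the unnormalized norms remain bounded. -/
theorem exists_iterN_le (hm : 2 ≤ m) (hA : IsIrreducibleFamily A) (hγ : IsAveraging γ)
    (hN0 : IsNorm N0) {s : ℝ} (hs : ∀ n, rhoInf A (iterN A γ N0 n) < s)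
    (hsγ : ∀ᶠ n in atTop, s < relaxParam A γ N0 n) :
    ∃ K, ∀ n x, iterN A γ N0 n x ≤ K * ‖x‖ := by
  have hN := isNorm_iterN hm hA hγ hN0
  have hs0 : 0 ≤ s := ((hN 0).rhoInf_pos hm hA).le.trans (hs 0).le
  set R := rhoSup A (iterN A γ N0 0)
  have hR : 0 ≤ R := ((hN 0).rhoInf_pos hm hA).le.trans ((hN 0).rhoInf_le_rhoSup A)
  obtain ⟨C, hC, hCN⟩ := hA.exists_uniform_le hR
  obtain ⟨k, hk⟩ := eventually_atTop.1 hsγ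
  have hback : ∀ j x, maxA A (iterN A γ N0 (k + j)) x ≤ s * iterN A γ N0 (k + j) x →
      iterN A γ N0 (k + j) x = iterN A γ N0 k x := by
    intro j
    induction j with
    | zero => exact fun _ _ => rfl
    | succ j ih =>
      intro x hx
      have := maxA_le_of_maxA_max_mul_maxA_le (hN (k + j)) hs0 (hk _ (Nat.le_add_right k j)) hx
      exact this.2.trans (ih x this.1)
  obtain ⟨D, hD⟩ : ∃ D, ∀ x, iterN A γ N0 k x ≤ D * ‖x‖ :=
    ⟨_, (hN k).isSeminorm.le_mul_norm⟩
  refine ⟨C * D, fun n y => ?_⟩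
  obtain ⟨x, hx, hlt⟩ := (hN (k + n)).exists_maxA_lt_of_rhoInf_lt (hs (k + n))
  have hx' : 0 < ‖x‖ := norm_pos_iff.2 hx
  have h1 := hCN _ (hN (k + n)).isSeminorm (fun i z =>
    (le_maxA A _ i z).trans (((hN (k + n)).maxA_le_rhoSup_mul A z).trans
      (mul_le_mul_of_nonneg_right
        (antitone_rhoSup_iterN hm hA hγ hN0 (Nat.zero_le (k + n))) ((hN (k + n)).1 z)))) x y
  rw [hback n x hlt.le] at h1
  have h2 := h1.trans (mul_le_mul_of_nonneg_left (hD x) (by positivity))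
  refine (monotone_iterN A γ N0 y (Nat.le_add_left n k)).trans
    (le_of_mul_le_mul_left (h2.trans_eq ?_) hx')
  ring

end Iteration

/-- the sequences `{ρ⁺_n}` and `{ρ⁻_n}` of the max-relaxation iteration
both converge to the joint spectral radius `ρ(𝒜)`. -/
theorem stmt1 {m r : ℕ} (hm : 2 ≤ m) (hr : 1 ≤ r)
    (A : Fin r → Matrix (Fin m) (Fin m) ℝ) (hA : IsIrreducibleFamily A)
    (γ : ℝ → ℝ → ℝ) (hγ : IsAveraging γ)
    (N0 : (Fin m → ℝ) → ℝ) (hN0 : IsNorm N0)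
    (e : Fin m → ℝ) (he : N0 e = 1) :
    Tendsto (fun n => rhoSup A (iterN A γ N0 n)) atTop (𝓝 (jsr A)) ∧
      Tendsto (fun n => rhoInf A (iterN A γ N0 n)) atTop (𝓝 (jsr A)) := by
  have : Nonempty (Fin m) := ⟨⟨0, by omega⟩⟩
  have : Nonempty (Fin r) := ⟨⟨0, by omega⟩⟩
  have hN := isNorm_iterN hm hA hγ hN0
  have hpos : ∀ n, 0 < rhoInf A (iterN A γ N0 n) := fun n => (hN n).rhoInf_pos hm hA
  have hle : ∀ n, rhoInf A (iterN A γ N0 n) ≤ rhoSup A (iterN A γ N0 n) := fun n =>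
    (hN n).rhoInf_le_rhoSup A
  have hmono := monotone_rhoInf_iterN hm hA hγ hN0
  have hanti := antitone_rhoSup_iterN hm hA hγ hN0
  have hjsr : ∀ n, jsr A ∈ Set.Icc (rhoInf A (iterN A γ N0 n)) (rhoSup A (iterN A γ N0 n)) :=
    fun n => jsr_mem_Icc (hN n) (hpos n).le ((hpos n).le.trans (hle n))
      ((hN n).rhoInf_mul_le_maxA A) ((hN n).maxA_le_rhoSup_mul A)
  have hbb : BddBelow (Set.range fun n => rhoSup A (iterN A γ N0 n)) :=
    ⟨jsr A, by rintro _ ⟨n, rfl⟩; exact (hjsr n).2⟩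
  have hba : BddAbove (Set.range fun n => rhoInf A (iterN A γ N0 n)) :=
    ⟨jsr A, by rintro _ ⟨n, rfl⟩; exact (hjsr n).1⟩
  have tb := tendsto_atTop_ciInf hanti hbb
  have ta := tendsto_atTop_ciSup hmono hba
  set α := ⨆ n, rhoInf A (iterN A γ N0 n)
  set β := ⨅ n, rhoSup A (iterN A γ N0 n)
  have hαn : ∀ n, rhoInf A (iterN A γ N0 n) ≤ α := le_ciSup hba
  have hβn : ∀ n, β ≤ rhoSup A (iterN A γ N0 n) := ciInf_le hbb
  have hαj : α ≤ jsr A := ciSup_le fun n => (hjsr n).1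
  have hjβ : jsr A ≤ β := le_ciInf fun n => (hjsr n).2
  have hα : 0 < α := (hpos 0).trans_le (hαn 0)
  suffices hαβ : α = β by
    rw [le_antisymm (hαβ ▸ hjβ) hαj]
    exact ⟨hαβ ▸ tb, ta⟩
  by_contra hne
  have hlt : α < β := (hαj.trans hjβ).lt_of_ne hne
  have hβ : 0 < β := hα.trans hlt
  have tg : Tendsto (relaxParam A γ N0) atTop (𝓝 (γ α β)) := hγ.tendsto hα hβ ta tb
  have hG := hγ.2.2 α β hα hβ hne
  rw [min_eq_left hlt.le, max_eq_right hlt.le] at hG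
  obtain ⟨s, hαs, hsG⟩ := exists_between hG.1
  obtain ⟨t, hGt, htβ⟩ := exists_between hG.2
  have ht : 0 < t := hα.trans (hG.1.trans hGt)
  obtain ⟨K, hK⟩ := exists_iterN_le hm hA hγ hN0 (fun n => (hαn n).trans_lt hαs)
    (tg.eventually_const_lt hsG)
  obtain ⟨u, htu, huβ⟩ := exists_between htβ
  have hε : 0 < u / t - 1 := by
    rw [sub_pos, lt_div_iff₀ ht, one_mul]
    exact htu
  obtain ⟨n, hn, hnt⟩ := ((eventually_succ_le_mul hN (monotone_iterN A γ N0) hK hε).and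
    (tg.eventually_lt_const hGt)).exists
  refine (huβ.trans_le (hβn n)).not_ge ((hN n).rhoSup_le fun x => ?_)
  have hg := relaxParam_pos hm hA hγ hN0 n
  have h1 : maxA A (iterN A γ N0 n) x ≤ relaxParam A γ N0 n * iterN A γ N0 (n + 1) x :=
    (inv_mul_le_iff₀ hg).1 (le_max_right _ _)
  calc maxA A (iterN A γ N0 n) x ≤ relaxParam A γ N0 n * iterN A γ N0 (n + 1) x := h1
    _ ≤ t * ((1 + (u / t - 1)) * iterN A γ N0 n x) :=
        mul_le_mul hnt.le (hn x) ((hN _).1 x) ht.le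
    _ = u * iterN A γ N0 n x := by field_simp; ring
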